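/- Let I be an ideal of a unital alternative algebra A and let H be a subloop of the Moufang loop U(A) of invertible elements of A. Then K = H ∩ (1 + I) = {h ∈ H : h − 1 ∈ I} is a normal subloop of H. -/

import Mathlib

/-- A (not necessarily associative) algebra is *alternative* if it satisfies
`x²y = x(xy)` and `(yx)x = yx²`. -/
def IsAlternative (A : Type*) [Mul A] : Prop :=
  (∀ x y : A, (x * x) * y = x * (x * y)) ∧ (∀ x y : A, (y * x) * x = y * (x * x))

/-- `H` is a subloop of the Moufang loop `U(A)` of invertible elements of a unital
(alternative) algebra `A`: it contains `1`, is closed under multiplication, and every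
element of `H` has a (two-sided) inverse lying in `H`. -/
def IsSubloopOfUnits (A : Type*) [NonAssocRing A] (H : Set A) : Prop :=
  (1 : A) ∈ H ∧ (∀ a ∈ H, ∀ b ∈ H, a * b ∈ H) ∧
    ∀ a ∈ H, ∃ b ∈ H, a * b = 1 ∧ b * a = 1

/-- `K` is a normal subloop of the loop `H`: it is contained in `H` and satisfies
`xK = Kx`, `(Kx)y = K(xy)` and `y(xK) = (yx)K` for all `x, y ∈ H`. -/
def IsNormalIn {A : Type*} [Mul A] (H K : Set A) : Prop :=
  K ⊆ H ∧
  (∀ x ∈ H, (fun k => x * k) '' K = (fun k => k * x) '' K) ∧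
  (∀ x ∈ H, ∀ y ∈ H, (fun k => (k * x) * y) '' K = (fun k => k * (x * y)) '' K) ∧
  (∀ x ∈ H, ∀ y ∈ H, (fun k => y * (x * k)) '' K = (fun k => (y * x) * k) '' K)

open MulOpposite

section Alternative

variable {A : Type*} [NonAssocRing A]

theorem IsAlternative.mulOpposite (hAlt : IsAlternative A) : IsAlternative Aᵐᵒᵖ :=
  ⟨fun x y => unop_injective (hAlt.2 x.unop y.unop).symm,
    fun x y => unop_injective (hAlt.1 x.unop y.unop).symm⟩

/-- Linearized left alternative law. -/
theorem IsAlternative.left_linearized (hAlt : IsAlternative A) (a b x : A) :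
    (a * b) * x + (b * a) * x = a * (b * x) + b * (a * x) := by
  have h := hAlt.1 (a + b) x
  have ha := hAlt.1 a x
  have hb := hAlt.1 b x
  simp only [mul_add, add_mul] at h
  rw [ha, hb] at h
  rw [← sub_eq_zero] at h ⊢
  rw [← h]
  abel

/-- Linearized right alternative law. -/
theorem IsAlternative.right_linearized (hAlt : IsAlternative A) (a b x : A) :
    (x * a) * b + (x * b) * a = x * (a * b) + x * (b * a) := by
  have h := congrArg unop (hAlt.mulOpposite.left_linearized (op b) (op a) (op x))
  simpa using h.symm

/-- Left Moufang identity. -/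
theorem IsAlternative.left_moufang (hAlt : IsAlternative A) (a b x : A) :
    ((a * b) * a) * x = a * (b * (a * x)) := by
  have h₁ := hAlt.left_linearized (a * b) a x
  have h₂ := hAlt.right_linearized b (a * x) a
  have h₃ := hAlt.right_linearized b x (a * a)
  have h₄ := congrArg (a * ·) (hAlt.right_linearized b x a)
  simp only [mul_add, ← hAlt.1] at h₁ h₂ h₃ h₄
  linear_combination (norm := abel) h₁ + h₂ - h₃ + h₄

/-- Right Moufang identity. -/
theorem IsAlternative.right_moufang (hAlt : IsAlternative A) (a b x : A) :
    ((x * a) * b) * a = x * (a * (b * a)) := by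
  simpa using congrArg unop (hAlt.mulOpposite.left_moufang (op a) (op b) (op x)).symm

/-- Left inverse property for invertible elements of an alternative ring. -/
theorem IsAlternative.mul_inv_cancel_left (hAlt : IsAlternative A) {y z : A}
    (hyz : y * z = 1) (hzy : z * y = 1) (x : A) : y * (z * x) = x := by
  obtain ⟨c, hc⟩ : ∃ c, c = x - y * (z * x) := ⟨_, rfl⟩
  have hzc : z * c = 0 := by
    have h := hAlt.left_moufang z y x
    rw [hzy, one_mul] at h
    rw [hc, mul_sub, ← h, sub_self]
  have hyc : y * c = 0 := by
    have h := hAlt.left_moufang y z x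
    have h₂ := congrArg (y * ·) (hAlt.left_linearized y z x)
    simp only [hyz, hzy, one_mul, mul_add, ← h] at h h₂
    rw [hc, mul_sub, add_right_cancel h₂, sub_self]
  have hcx : c = x - (x * z) * y := by
    have h₁ := hAlt.right_linearized z x y
    have h₂ := hAlt.left_linearized y x z
    have h₃ := hAlt.right_linearized y z x
    simp only [hyz, hzy, one_mul, mul_one] at h₁ h₂ h₃
    linear_combination (norm := abel) hc + h₁ - h₂ + h₃
  have hcz : c * z = 0 := by
    have h := hAlt.right_moufang z y x
    rw [hyz, mul_one] at h
    rw [hcx, sub_mul, h, sub_self]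
  have h := hAlt.right_linearized z c y
  rw [hyz, hyc, hzc, hcz, one_mul, zero_mul, mul_zero, add_zero, add_zero] at h
  exact (sub_eq_zero.mp (hc.symm.trans h)).symm

/-- Right inverse property for invertible elements of an alternative ring. -/
theorem IsAlternative.mul_inv_cancel_right (hAlt : IsAlternative A) {y z : A}
    (hyz : y * z = 1) (hzy : z * y = 1) (x : A) : (x * z) * y = x := by
  simpa using congrArg unop (hAlt.mulOpposite.mul_inv_cancel_left (y := op y) (z := op z)
    (congrArg op hzy) (congrArg op hyz) (op x))

/-- Right translates `(Kx)y` of `K = H ∩ (1 + I)` are residue classes modulo `I`. -/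
theorem IsAlternative.image_mul_right_mul_right (hAlt : IsAlternative A) (I : TwoSidedIdeal A)
    {H : Set A} (hH : IsSubloopOfUnits A H) {x y : A} (hx : x ∈ H) (hy : y ∈ H) :
    (fun k => (k * x) * y) '' {h ∈ H | h - 1 ∈ I} = {z ∈ H | z - x * y ∈ I} := by
  obtain ⟨-, hmul, hinv⟩ := hH
  ext z
  constructor
  · rintro ⟨k, ⟨hk, hkI⟩, rfl⟩
    refine ⟨hmul _ (hmul _ hk _ hx) _ hy, ?_⟩
    have h := I.mul_mem_right _ y (I.mul_mem_right _ x hkI)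
    simpa only [sub_mul, one_mul] using h
  · rintro ⟨hz, hzI⟩
    obtain ⟨x', hx', hxx', hx'x⟩ := hinv x hx
    obtain ⟨y', hy', hyy', hy'y⟩ := hinv y hy
    refine ⟨(z * y') * x', ⟨hmul _ (hmul _ hz _ hy') _ hx', ?_⟩, ?_⟩
    · have h := I.mul_mem_right _ x' (I.mul_mem_right _ y' hzI)
      rwa [sub_mul, sub_mul, hAlt.mul_inv_cancel_right hy'y hyy', hxx'] at h
    · simp only [hAlt.mul_inv_cancel_right hxx' hx'x, hAlt.mul_inv_cancel_right hyy' hy'y]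

/-- Left translates `y(xK)` of `K = H ∩ (1 + I)` are residue classes modulo `I`. -/
theorem IsAlternative.image_mul_left_mul_left (hAlt : IsAlternative A) (I : TwoSidedIdeal A)
    {H : Set A} (hH : IsSubloopOfUnits A H) {x y : A} (hx : x ∈ H) (hy : y ∈ H) :
    (fun k => y * (x * k)) '' {h ∈ H | h - 1 ∈ I} = {z ∈ H | z - y * x ∈ I} := by
  obtain ⟨-, hmul, hinv⟩ := hH
  ext z
  constructor
  · rintro ⟨k, ⟨hk, hkI⟩, rfl⟩
    refine ⟨hmul _ hy _ (hmul _ hx _ hk), ?_⟩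
    have h := I.mul_mem_left y _ (I.mul_mem_left x _ hkI)
    simpa only [mul_sub, mul_one] using h
  · rintro ⟨hz, hzI⟩
    obtain ⟨x', hx', hxx', hx'x⟩ := hinv x hx
    obtain ⟨y', hy', hyy', hy'y⟩ := hinv y hy
    refine ⟨x' * (y' * z), ⟨hmul _ hx' _ (hmul _ hy' _ hz), ?_⟩, ?_⟩
    · have h := I.mul_mem_left x' _ (I.mul_mem_left y' _ hzI)
      rwa [mul_sub, mul_sub, hAlt.mul_inv_cancel_left hy'y hyy', hx'x] at h
    · simp only [hAlt.mul_inv_cancel_left hxx' hx'x, hAlt.mul_inv_cancel_left hyy' hy'y]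

/-- The set `H ∩ (1 + I)` is a subloop. -/
theorem IsSubloopOfUnits.inter_one_add_ideal (I : TwoSidedIdeal A) {H : Set A}
    (hH : IsSubloopOfUnits A H) : IsSubloopOfUnits A {h ∈ H | h - 1 ∈ I} := by
  obtain ⟨hone, hmul, hinv⟩ := hH
  refine ⟨⟨hone, by simp⟩, ?_, ?_⟩
  · rintro a ⟨ha, haI⟩ b ⟨hb, hbI⟩
    refine ⟨hmul a ha b hb, ?_⟩
    simpa [sub_mul] using I.add_mem (I.mul_mem_right _ b haI) hbI
  · rintro a ⟨ha, haI⟩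
    obtain ⟨b, hb, hab, hba⟩ := hinv a ha
    refine ⟨b, ⟨hb, ?_⟩, hab, hba⟩
    simpa [sub_mul, hab] using I.neg_mem (I.mul_mem_right _ b haI)

end Alternative

/-- **Lemma.** Let `I` be an ideal of a unital alternative algebra `A` and let `H` be a
subloop of the Moufang loop `U(A)` of invertible elements of `A`.  Then
`K = H ∩ (1 + I) = {h ∈ H : h - 1 ∈ I}` is a normal subloop of `H`. -/
theorem inter_one_add_ideal_normal_subloop
    {A : Type*} [NonAssocRing A] (hAlt : IsAlternative A)
    (I : TwoSidedIdeal A) (H : Set A) (hH : IsSubloopOfUnits A H) :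
    IsSubloopOfUnits A {h ∈ H | h - 1 ∈ I} ∧ IsNormalIn H {h ∈ H | h - 1 ∈ I} := by
  refine ⟨hH.inter_one_add_ideal I, fun h hh => hh.1, fun x hx => ?_, fun x hx y hy => ?_,
    fun x hx y hy => ?_⟩
  · have hl := hAlt.image_mul_left_mul_left I hH hx hH.1
    have hr := hAlt.image_mul_right_mul_right I hH hx hH.1
    simp only [one_mul, mul_one] at hl hr
    exact hl.trans hr.symm
  · have h := hAlt.image_mul_right_mul_right I hH (hH.2.1 x hx y hy) hH.1
    simp only [mul_one] at h
    exact (hAlt.image_mul_right_mul_right I hH hx hy).trans h.symm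
  · have h := hAlt.image_mul_left_mul_left I hH (hH.2.1 y hy x hx) hH.1
    simp only [one_mul] at h
    exact (hAlt.image_mul_left_mul_left I hH hx hy).trans h.symm
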